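/- arXiv:1806.03206 — 2 statements merged into one kernel-verified Lean document; each statement's English description precedes it below -/
import Mathlib

section
/- Let X be a Polish space and let d be a complete compatible proper metric on X (i.e. all closed d-balls are compact). Then any pair of presentations P = (X, d, x̄) and S = (X, d, ȳ) with the same metric d satisfies φ_P(F) = φ_S(F) for every countable closed F ⊆ X. -/
open Set Filter Topology

/-- A presentation `(X, d, x̄)` of a Polish space `X`: a complete metric `d`
compatible with the topology of `X`, together with a dense sequence `x̄`. -/
structure Presentation (X : Type) [TopologicalSpace X] where
  dist : X → X → ℝ
  seq : ℕ → X
  dist_self : ∀ x, dist x x = 0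
  eq_of_dist_eq_zero : ∀ x y, dist x y = 0 → x = y
  dist_comm : ∀ x y, dist x y = dist y x
  dist_triangle : ∀ x y z, dist x z ≤ dist x y + dist y z
  /-- `d` is compatible with the topology of `X`. -/
  isOpen_iff : ∀ s : Set X, IsOpen s ↔ ∀ x ∈ s, ∃ ε > 0, ∀ y, dist y x < ε → y ∈ s
  /-- `d` is complete. -/
  complete : ∀ u : ℕ → X, (∀ ε > 0, ∃ N, ∀ m ≥ N, ∀ n ≥ N, dist (u m) (u n) < ε) →
      ∃ x, ∀ ε > 0, ∃ N, ∀ n ≥ N, dist (u n) x < ε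
  /-- the sequence `x̄` is dense. -/
  dense : ∀ x, ∀ ε > 0, ∃ i, dist x (seq i) < ε

namespace Presentation

variable {X : Type} [TopologicalSpace X] (P : Presentation X)

/-- The open ball `B_P(n)`. -/
def ball (n : ℕ × ℕ) : Set X := {x | P.dist x (P.seq n.1) < (1/2 : ℝ) ^ (n.2 + 1)}

/-- The closed ball `B̄_P(n)`. -/
def cball (n : ℕ × ℕ) : Set X := {x | P.dist x (P.seq n.1) ≤ (1/2 : ℝ) ^ (n.2 + 1)}

/-- The relation `n ≺_P m`. -/
def prec (n m : ℕ × ℕ) : Prop := n.2 < m.2 ∧ P.cball m ⊆ P.ball n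

/-- The relation `n ⋏_P m`. -/
def apart (n m : ℕ × ℕ) : Prop := P.cball n ∩ P.cball m = ∅

/-- The code `A_F^P` of a closed set `F ⊆ X`. -/
def code (F : Set X) : Set (ℕ × ℕ) := {n | (P.ball n ∩ F).Nonempty}

/-- The derivative `D_P` on subsets of `ω × ω`. -/
def deriv (A : Set (ℕ × ℕ)) : Set (ℕ × ℕ) :=
  {n ∈ A | ∃ u ∈ A, ∃ v ∈ A, P.prec n u ∧ P.prec n v ∧ P.apart u v}

/-- The transfinite iterates `D_P^α(A)`. -/
noncomputable def derivIter (A : Set (ℕ × ℕ)) (α : Ordinal.{0}) : Set (ℕ × ℕ) :=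
  Ordinal.limitRecOn α A (fun _ ih => P.deriv ih)
    (fun o _ ih => ⋂ (β : {β : Ordinal.{0} // β < o}), ih β.1 β.2)

/-- The rank `|A|_P`: the least ordinal `α` with `D_P^α(A) = D_P^{α+1}(A)`. -/
noncomputable def rankA (A : Set (ℕ × ℕ)) : Ordinal.{0} :=
  sInf {α | P.derivIter A (α + 1) = P.derivIter A α}

/-- The rank `φ_P(F) = |A_F^P|_P` of a (countable closed) subset `F ⊆ X`. -/
noncomputable def phi (F : Set X) : Ordinal.{0} := P.rankA (P.code F)

/-- `A ⊆ ω × ω` is `P`-closed. -/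
def PClosed (A : Set (ℕ × ℕ)) : Prop := ∀ n ∈ A, ∀ m, P.prec m n → m ∈ A

/-- `A ⊆ ω × ω` is `P`-pruned. -/
def PPruned (A : Set (ℕ × ℕ)) : Prop := ∀ n ∈ A, ∃ m ∈ A, P.prec n m

/-- `A ⊆ ω × ω` is `P`-perfect. -/
def PPerfect (A : Set (ℕ × ℕ)) : Prop :=
  ∀ n ∈ A, ∃ u ∈ A, ∃ v ∈ A, P.prec n u ∧ P.prec n v ∧ P.apart u v

/-- The set `[A]_P` of `P`-compatible sequences lying in `A`. -/
def body (A : Set (ℕ × ℕ)) : Set (ℕ → ℕ × ℕ) :=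
  {f | (∀ i, P.prec (f i) (f (i + 1))) ∧ ∀ i, f i ∈ A}

/-- The set `F_A^P = π_P([A]_P)`: the points obtained as the unique point of
`⋂_i B_P(n_i)` for a `P`-compatible sequence `(n_i)` in `A`. -/
def limitSet (A : Set (ℕ × ℕ)) : Set X :=
  {x | ∃ f ∈ P.body A, ∀ i, x ∈ P.ball (f i)}

end Presentation

section CB

variable {X : Type} [TopologicalSpace X]

/-- The Cantor–Bendixson derivative: the set of limit points of `F` in `F`. -/
def cbDeriv (F : Set X) : Set X := {x ∈ F | AccPt x (𝓟 F)}

/-- The iterated Cantor–Bendixson derivatives `F^α`. -/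
noncomputable def cbIter (F : Set X) (α : Ordinal.{0}) : Set X :=
  Ordinal.limitRecOn α F (fun _ ih => cbDeriv ih)
    (fun o _ ih => ⋂ (β : {β : Ordinal.{0} // β < o}), ih β.1 β.2)

/-- The Cantor–Bendixson rank `|F|_CB`. -/
noncomputable def cbRank (F : Set X) : Ordinal.{0} :=
  sInf {α | cbIter F (α + 1) = cbIter F α}

/-- The `K_σ`-derivative of a subset `A ⊆ X`: the points of `A` having no open
neighborhood in the subspace `A` whose closure in `A` is compact. -/
def kDeriv (A : Set X) : Set X :=
  {x ∈ A | ∀ U : Set X, IsOpen U → x ∈ U → ¬ IsCompact (A ∩ closure (U ∩ A))}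

/-- The iterated `K_σ`-derivatives `X_α` of the space `X`. -/
noncomputable def kIter (X : Type) [TopologicalSpace X] (α : Ordinal.{0}) : Set X :=
  Ordinal.limitRecOn α Set.univ (fun _ ih => kDeriv ih)
    (fun o _ ih => ⋂ (β : {β : Ordinal.{0} // β < o}), ih β.1 β.2)

/-- The `K_σ`-rank `|X|_{K_σ}`. -/
noncomputable def kRank (X : Type) [TopologicalSpace X] : Ordinal.{0} :=
  sInf {α | kIter X (α + 1) = kIter X α}

end CB

/-- In a proper metric space, containment of a closed ball in an open set is stable under small
perturbations of the centre. -/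
theorem exists_pos_closedBall_subset {X : Type*} [MetricSpace X] [ProperSpace X] {c : X} {r : ℝ}
    {V : Set X} (hV : IsOpen V) (h : Metric.closedBall c r ⊆ V) :
    ∃ δ > 0, ∀ c', dist c' c < δ → Metric.closedBall c' r ⊆ V := by
  have hK : IsCompact (Metric.closedBall c (r + 1) \ V) :=
    (isCompact_closedBall c (r + 1)).diff hV
  rcases (Metric.closedBall c (r + 1) \ V).eq_empty_or_nonempty with he | hne
  · refine ⟨1, one_pos, fun c' hc' => ?_⟩
    exact (Metric.closedBall_subset_closedBall' (by linarith)).trans (sdiff_eq_empty.1 he)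
  · obtain ⟨y, hy, hmin⟩ :=
      hK.exists_isMinOn hne (f := fun y => dist y c) (by fun_prop)
    have hyr : r < dist y c := by
      by_contra! hle
      exact hy.2 (h hle)
    refine ⟨min 1 (dist y c - r), lt_min one_pos (sub_pos.2 hyr), fun c' hc' z hz => ?_⟩
    have h1 : dist c' c < 1 := hc'.trans_le (min_le_left _ _)
    have h2 : dist c' c < dist y c - r := hc'.trans_le (min_le_right _ _)
    have hzc : dist z c ≤ dist z c' + dist c' c := dist_triangle _ _ _
    have hzr : dist z c' ≤ r := hz
    by_contra hzV
    have h3 : dist y c ≤ dist z c := hmin ⟨Metric.mem_closedBall.2 (by linarith), hzV⟩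
    linarith

/-- In a proper metric space, containment of a closed set in an open ball is stable under small
perturbations of the centre. -/
theorem exists_pos_subset_ball {X : Type*} [MetricSpace X] [ProperSpace X] {c : X} {r : ℝ}
    {K : Set X} (hK : IsClosed K) (h : K ⊆ Metric.ball c r) :
    ∃ δ > 0, ∀ c', dist c' c < δ → K ⊆ Metric.ball c' r := by
  obtain ⟨r', hr', hKr⟩ := exists_lt_subset_ball hK h
  refine ⟨r - r', sub_pos.2 hr', fun c' hc' => hKr.trans (Metric.ball_subset_ball' ?_)⟩
  rw [dist_comm]
  linarith

namespace Presentation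

section Order

variable {X : Type} [TopologicalSpace X] {P : Presentation X} {A : Set (ℕ × ℕ)}

theorem ball_subset_cball (n : ℕ × ℕ) : P.ball n ⊆ P.cball n := by
  intro x hx
  exact le_of_lt (show P.dist x (P.seq n.1) < _ from hx)

theorem prec_trans {n m k : ℕ × ℕ} (h₁ : P.prec n m) (h₂ : P.prec m k) : P.prec n k :=
  ⟨h₁.1.trans h₂.1, h₂.2.trans ((ball_subset_cball m).trans h₁.2)⟩

@[simp]
theorem derivIter_zero : P.derivIter A 0 = A := by
  simp [derivIter]

@[simp]
theorem derivIter_add_one (α : Ordinal.{0}) :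
    P.derivIter A (α + 1) = P.deriv (P.derivIter A α) := by
  simp [derivIter]

theorem mem_derivIter_limit {l : Ordinal.{0}} (hl : Order.IsSuccLimit l) {n : ℕ × ℕ} :
    n ∈ P.derivIter A l ↔ ∀ β < l, n ∈ P.derivIter A β := by
  simp [derivIter, Ordinal.limitRecOn_limit _ _ _ _ hl]

theorem deriv_subset : P.deriv A ⊆ A := fun _ h => h.1

theorem derivIter_antitone : Antitone (P.derivIter A) := by
  intro α β hαβ
  induction β using Ordinal.limitRecOn with
  | zero => rw [nonpos_iff_eq_zero.1 hαβ]
  | add_one β ih =>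
    rcases hαβ.eq_or_lt with rfl | hlt
    · exact le_rfl
    · rw [derivIter_add_one]
      exact deriv_subset.trans (ih (Order.lt_add_one_iff.1 hlt))
  | limit l hl ih =>
    rcases hαβ.eq_or_lt with rfl | hlt
    · exact le_rfl
    · exact fun n hn => (mem_derivIter_limit hl).1 hn α hlt

theorem derivIter_subset (α : Ordinal.{0}) : P.derivIter A α ⊆ A := by
  simpa using derivIter_antitone (P := P) (A := A) (zero_le (a := α))

theorem PClosed.deriv (hA : P.PClosed A) : P.PClosed (P.deriv A) := by
  rintro n ⟨hn, u, hu, v, hv, hnu, hnv, huv⟩ m hmn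
  exact ⟨hA n hn m hmn, u, hu, v, hv, prec_trans hmn hnu, prec_trans hmn hnv, huv⟩

theorem PClosed.derivIter (hA : P.PClosed A) (α : Ordinal.{0}) : P.PClosed (P.derivIter A α) := by
  induction α using Ordinal.limitRecOn with
  | zero => simpa using hA
  | add_one α ih => simpa using ih.deriv
  | limit l hl ih =>
    intro n hn m hmn
    rw [mem_derivIter_limit hl] at hn ⊢
    exact fun β hβ => ih β hβ n (hn β hβ) m hmn

theorem pClosed_code (F : Set X) : P.PClosed (P.code F) := fun n hn _ hmn =>
  hn.mono (inter_subset_inter_left F ((ball_subset_cball n).trans hmn.2))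

/-- A ball surviving `N` more derivatives contains the centre of a surviving ball at
least `N` levels deeper. -/
theorem exists_deep_of_mem_derivIter_add {α : Ordinal.{0}} (N : ℕ) {u : ℕ × ℕ}
    (hu : u ∈ P.derivIter A (α + N)) :
    ∃ l ∈ P.derivIter A α, u.2 + N ≤ l.2 ∧ P.seq l.1 ∈ P.cball u := by
  induction N generalizing u with
  | zero =>
    refine ⟨u, by simpa using hu, by simp, ?_⟩
    change P.dist _ _ ≤ _
    rw [P.dist_self]
    positivity
  | succ N ih =>
    rw [Nat.cast_succ, ← add_assoc, derivIter_add_one] at hu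
    obtain ⟨-, w, hw, -, -, huw, -, -⟩ := hu
    obtain ⟨l, hl, hwl, hc⟩ := ih hw
    have hwu : P.cball w ⊆ P.cball u := huw.2.trans (ball_subset_cball u)
    exact ⟨l, hl, by have := huw.1; omega, hwu hc⟩

end Order

section Proper

variable {X : Type} [MetricSpace X] {P S : Presentation X}

theorem ball_eq (hP : P.dist = Dist.dist) (n : ℕ × ℕ) :
    P.ball n = Metric.ball (P.seq n.1) ((1 / 2) ^ (n.2 + 1)) := by
  simp only [ball, hP]; rfl

theorem cball_eq (hP : P.dist = Dist.dist) (n : ℕ × ℕ) :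
    P.cball n = Metric.closedBall (P.seq n.1) ((1 / 2) ^ (n.2 + 1)) := by
  simp only [cball, hP]; rfl

theorem exists_seq_dist_lt (hP : P.dist = Dist.dist) (x : X) {δ : ℝ} (hδ : 0 < δ) :
    ∃ i, Dist.dist (P.seq i) x < δ := by
  obtain ⟨i, hi⟩ := P.dense x δ hδ
  exact ⟨i, by rwa [P.dist_comm, hP] at hi⟩

/-- Coded closed balls of arbitrarily high level around a point form a neighbourhood basis. -/
theorem exists_mem_ball_cball_subset (hP : P.dist = Dist.dist) {x : X} {V : Set X}
    (hV : IsOpen V) (hx : x ∈ V) (N : ℕ) :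
    ∃ m : ℕ × ℕ, N ≤ m.2 ∧ x ∈ P.ball m ∧ P.cball m ⊆ V := by
  obtain ⟨ε, hε, hεV⟩ := Metric.isOpen_iff.1 hV x hx
  obtain ⟨k, hk⟩ := exists_pow_lt_of_lt_one (half_pos hε) (by norm_num : (1 / 2 : ℝ) < 1)
  have hpow : (1 / 2 : ℝ) ^ (max N k + 1) ≤ (1 / 2) ^ k :=
    pow_le_pow_of_le_one (by norm_num) (by norm_num) (by omega)
  obtain ⟨i, hi⟩ := exists_seq_dist_lt hP x
    (by positivity : (0 : ℝ) < (1 / 2) ^ (max N k + 1))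
  refine ⟨(i, max N k), le_max_left _ _, ?_, ?_⟩
  · rw [ball_eq hP, Metric.mem_ball, _root_.dist_comm]
    exact hi
  · rw [cball_eq hP]
    refine subset_trans (fun z hz => ?_) hεV
    have hz' : Dist.dist z (P.seq i) ≤ (1 / 2) ^ (max N k + 1) := hz
    rw [Metric.mem_ball]
    linarith [_root_.dist_triangle z (P.seq i) x]

variable [ProperSpace X]

/-- At a limit stage, a surviving ball contains a point all of whose coded neighbourhoods
survive. -/
theorem exists_mem_cball_forall_mem_derivIter (hP : P.dist = Dist.dist) {A : Set (ℕ × ℕ)}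
    (hA : P.PClosed A) {l : Ordinal.{0}} (hl : Order.IsSuccLimit l) {u : ℕ × ℕ}
    (hu : u ∈ P.derivIter A l) :
    ∃ a ∈ P.cball u, ∀ m, a ∈ P.ball m → m ∈ P.derivIter A l := by
  by_contra! hcon
  have hK : IsCompact (P.cball u) := by
    rw [cball_eq hP]
    exact isCompact_closedBall _ _
  have key : ∃ α < l, ∃ N : ℕ, ∀ k ∈ P.derivIter A α, N ≤ k.2 → P.seq k.1 ∉ P.cball u := by
    refine hK.induction_on
      (p := fun s => ∃ α < l, ∃ N : ℕ, ∀ k ∈ P.derivIter A α, N ≤ k.2 → P.seq k.1 ∉ s)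
      ⟨0, hl.bot_lt, 0, fun _ _ _ => notMem_empty _⟩ ?_ ?_ ?_
    · rintro s t hst ⟨α, hα, N, h⟩
      exact ⟨α, hα, N, fun k hk hN hks => h k hk hN (hst hks)⟩
    · rintro s t ⟨α, hα, N, h⟩ ⟨β, hβ, M, h'⟩
      refine ⟨max α β, max_lt hα hβ, max N M, fun k hk hN => ?_⟩
      rintro (hks | hkt)
      · exact h k (derivIter_antitone (le_max_left _ _) hk) (by omega) hks
      · exact h' k (derivIter_antitone (le_max_right _ _) hk) (by omega) hkt
    · intro a ha
      obtain ⟨m, ham, hm⟩ := hcon a ha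
      rw [mem_derivIter_limit hl] at hm
      push Not at hm
      obtain ⟨α, hα, hm⟩ := hm
      rw [ball_eq hP] at ham
      obtain ⟨ε, hε, hεm⟩ := Metric.isOpen_iff.1 Metric.isOpen_ball a ham
      obtain ⟨N, hN⟩ := exists_pow_lt_of_lt_one (half_pos hε) (by norm_num : (1 / 2 : ℝ) < 1)
      refine ⟨Metric.ball a (ε / 2), mem_nhdsWithin_of_mem_nhds (Metric.ball_mem_nhds a
        (half_pos hε)), α, hα, max N (m.2 + 1), fun k hk hNk hka => hm ?_⟩
      refine hA.derivIter α k hk m ⟨by omega, ?_⟩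
      rw [ball_eq hP, cball_eq hP]
      refine subset_trans (fun z hz => ?_) hεm
      have hpow : (1 / 2 : ℝ) ^ (k.2 + 1) ≤ (1 / 2) ^ N :=
        pow_le_pow_of_le_one (by norm_num) (by norm_num) (by omega)
      rw [Metric.mem_closedBall] at hz
      rw [Metric.mem_ball] at hka ⊢
      linarith [_root_.dist_triangle z (P.seq k.1) a]
  obtain ⟨α, hα, N, h⟩ := key
  obtain ⟨k, hk, hNk, hck⟩ := exists_deep_of_mem_derivIter_add N
    ((mem_derivIter_limit hl).1 hu (α + N) (hl.add_natCast_lt hα N))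
  exact h k hk (by omega) hck

/-- Every ball surviving in one presentation can be replaced by a surviving ball of any other
presentation of the same proper metric, of no lower level and inside any prescribed neighbourhood. -/
theorem exists_mem_derivIter_of_dist_eq (hP : P.dist = Dist.dist) (hS : S.dist = Dist.dist)
    (F : Set X) (α : Ordinal.{0}) {u : ℕ × ℕ} (hu : u ∈ P.derivIter (P.code F) α)
    {V : Set X} (hV : IsOpen V) (huV : P.cball u ⊆ V) :
    ∃ w ∈ S.derivIter (S.code F) α, u.2 ≤ w.2 ∧ S.cball w ⊆ V := by
  induction α using Ordinal.limitRecOn generalizing u V with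
  | zero =>
    rw [derivIter_zero] at hu ⊢
    obtain ⟨x, hxu, hxF⟩ := hu
    obtain ⟨w, hw, hxw, hwV⟩ :=
      exists_mem_ball_cball_subset hS hV (huV (ball_subset_cball u hxu)) u.2
    exact ⟨w, ⟨x, hxw, hxF⟩, hw, hwV⟩
  | add_one α ih =>
    rw [derivIter_add_one] at hu
    obtain ⟨-, v, hv, v', hv', huv, huv', hap⟩ := hu
    have hbo : IsOpen (P.ball u) := by
      rw [ball_eq hP]
      exact Metric.isOpen_ball
    have hcl : ∀ (Q : Presentation X), Q.dist = Dist.dist → ∀ n, IsClosed (Q.cball n) := by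
      intro Q hQ n
      rw [cball_eq hQ]
      exact Metric.isClosed_closedBall
    obtain ⟨U, U', hU, hU', hvU, hvU', hUU'⟩ := normal_separation (hcl P hP v) (hcl P hP v')
      (disjoint_iff_inter_eq_empty.2 hap)
    obtain ⟨w, hw, hwl, hwU⟩ := ih hv (hU.inter hbo) (subset_inter hvU huv.2)
    obtain ⟨w', hw', hwl', hwU'⟩ := ih hv' (hU'.inter hbo) (subset_inter hvU' huv'.2)
    obtain ⟨δ, hδ, hδu⟩ := exists_pos_subset_ball ((hcl S hS w).union (hcl S hS w'))
      (union_subset (hwU.trans inter_subset_right) (hwU'.trans inter_subset_right)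
        |>.trans (ball_eq hP u).subset)
    obtain ⟨δ', hδ', hδV⟩ := exists_pos_closedBall_subset hV ((cball_eq hP u).symm.subset.trans huV)
    obtain ⟨i, hi⟩ := exists_seq_dist_lt hS (P.seq u.1) (lt_min hδ hδ')
    have hsub : S.cball w ∪ S.cball w' ⊆ S.ball (i, u.2) := by
      rw [ball_eq hS]
      exact hδu _ (hi.trans_le (min_le_left _ _))
    have hw₁ : S.prec (i, u.2) w := ⟨huv.1.trans_le hwl, subset_union_left.trans hsub⟩
    have hw₂ : S.prec (i, u.2) w' := ⟨huv'.1.trans_le hwl', subset_union_right.trans hsub⟩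
    refine ⟨(i, u.2), ?_, le_rfl, ?_⟩
    · rw [derivIter_add_one]
      exact ⟨(pClosed_code F).derivIter α w hw _ hw₁, w, hw, w', hw', hw₁, hw₂,
        disjoint_iff_inter_eq_empty.1 (hUU'.mono (hwU.trans inter_subset_left)
          (hwU'.trans inter_subset_left))⟩
    · rw [cball_eq hS]
      exact hδV _ (hi.trans_le (min_le_right _ _))
  | limit l hl ih =>
    obtain ⟨a, hau, ha⟩ := exists_mem_cball_forall_mem_derivIter hP (pClosed_code F) hl hu
    obtain ⟨w, hwl, haw, hwV⟩ := exists_mem_ball_cball_subset hS hV (huV hau) u.2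
    refine ⟨w, (mem_derivIter_limit hl).2 fun β hβ => ?_, hwl, hwV⟩
    have hwo : IsOpen (S.ball w) := by
      rw [ball_eq hS]
      exact Metric.isOpen_ball
    obtain ⟨p, hpl, hap, hpw⟩ := exists_mem_ball_cball_subset hP hwo haw (w.2 + 1)
    obtain ⟨k, hk, hkl, hkw⟩ := ih β hβ ((mem_derivIter_limit hl).1 (ha p hap) β hβ) hwo hpw
    exact (pClosed_code F).derivIter β k hk w ⟨by omega, hkw⟩

/-- A perfect subset of the code of a countable closed set is empty. -/
theorem PPerfect.eq_empty (hP : P.dist = Dist.dist) {F : Set X} (hF : IsClosed F)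
    (hcnt : F.Countable) {A : Set (ℕ × ℕ)} (hA : P.PPerfect A) (hAF : A ⊆ P.code F) : A = ∅ := by
  by_contra hne
  obtain ⟨n₀, hn₀⟩ := nonempty_iff_ne_empty.2 hne
  obtain ⟨f, rfl⟩ := hcnt.exists_eq_range ((hAF hn₀).mono inter_subset_right)
  have step : ∀ (i : ℕ) (n : A), ∃ m : A, P.prec n m ∧ f i ∉ P.cball m := by
    rintro i ⟨n, hn⟩
    obtain ⟨u, hu, v, hv, hnu, hnv, huv⟩ := hA n hn
    by_cases h : f i ∈ P.cball u
    · exact ⟨⟨v, hv⟩, hnv, fun h' => notMem_empty _ (huv.subset ⟨h, h'⟩)⟩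
    · exact ⟨⟨u, hu⟩, hnu, h⟩
  choose g hg hgf using step
  let s : ℕ → A := fun k => Nat.rec ⟨n₀, hn₀⟩ g k
  have hcl : ∀ n, IsCompact (P.cball n) := by
    intro n
    rw [cball_eq hP]
    exact isCompact_closedBall _ _
  obtain ⟨x, hx⟩ := IsCompact.nonempty_iInter_of_sequence_nonempty_isCompact_isClosed
    (fun i => P.cball (s i).1 ∩ range f)
    (fun i => inter_subset_inter_left _ ((hg i (s i)).2.trans (ball_subset_cball (s i).1)))
    (fun i => Nonempty.mono (inter_subset_inter_left _ (ball_subset_cball (s i).1)) (hAF (s i).2))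
    ((hcl _).inter_right hF) (fun i => (hcl _).isClosed.inter hF)
  rw [mem_iInter] at hx
  obtain ⟨i, rfl⟩ := (hx 0).2
  exact hgf i (s i) (hx (i + 1)).1

/-- For countable closed sets the derivatives stabilise exactly when they become empty. -/
theorem derivIter_code_stable_iff (hP : P.dist = Dist.dist) {F : Set X} (hF : IsClosed F)
    (hcnt : F.Countable) (α : Ordinal.{0}) :
    P.derivIter (P.code F) (α + 1) = P.derivIter (P.code F) α ↔
      P.derivIter (P.code F) α = ∅ := by
  rw [derivIter_add_one]
  constructor
  · intro h
    refine PPerfect.eq_empty hP hF hcnt (fun n hn => ?_) (derivIter_subset α)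
    rw [← h] at hn
    exact hn.2
  · intro h
    rw [h]
    exact subset_empty_iff.1 deriv_subset

/-- The rank of a countable closed set depends only on the proper metric. -/
theorem phi_eq_of_dist_eq (hP : P.dist = Dist.dist) (hS : S.dist = Dist.dist) {F : Set X}
    (hF : IsClosed F) (hcnt : F.Countable) : P.phi F = S.phi F := by
  have aux : ∀ {Q R : Presentation X}, Q.dist = Dist.dist → R.dist = Dist.dist → ∀ α,
      R.derivIter (R.code F) α = ∅ → Q.derivIter (Q.code F) α = ∅ := by
    intro Q R hQ hR α h
    refine eq_empty_of_forall_notMem fun u hu => ?_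
    obtain ⟨w, hw, -⟩ := exists_mem_derivIter_of_dist_eq hQ hR F α hu isOpen_univ (subset_univ _)
    exact notMem_empty _ (h.subset hw)
  unfold phi rankA
  congr 1
  ext α
  simp only [mem_ofPred_eq, derivIter_code_stable_iff hP hF hcnt,
    derivIter_code_stable_iff hS hF hcnt]
  exact ⟨aux hS hP α, aux hP hS α⟩

end Proper

/-- The metric space structure underlying a presentation, with its given topology. -/
@[reducible]
def toMetricSpace {X : Type} [TopologicalSpace X] (P : Presentation X) : MetricSpace X :=
  MetricSpace.ofDistTopology P.dist P.dist_self P.dist_comm P.dist_triangle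
    (fun s => by simp only [P.dist_comm _, P.isOpen_iff]) P.eq_of_dist_eq_zero

end Presentation

/-- If `d` is a complete compatible proper metric on `X` (all closed balls
compact), then any two presentations with metric `d` give the same rank on countable
closed sets. -/
theorem stmt10 {X : Type} [TopologicalSpace X] [PolishSpace X]
    (P S : Presentation X) (hPS : S.dist = P.dist)
    (hproper : ∀ (x : X) (r : ℝ), IsCompact {y | P.dist y x ≤ r})
    (F : Set X) (hF : IsClosed F) (hcnt : F.Countable) :
    P.phi F = S.phi F := by
  let _ : MetricSpace X := P.toMetricSpace
  have : ProperSpace X := ⟨fun x r => hproper x r⟩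
  exact Presentation.phi_eq_of_dist_eq (P := P) (S := S) rfl hPS hF hcnt
end

section
/- For every countable ordinal α with α ≥ 1 there exists a complete metric d_α on the countable set ω inducing the discrete topology and with finite diameter, such that the presentation P_α = (ω, d_α, (n)_{n∈ω}) (with the identity enumeration of ω as dense sequence) satisfies φ_{P_α}(ω) = α, where ω is regarded as a countable closed subset of itself. -/
open Set Filter Topology

/-- The labels of the tree of rank `α`: countably many copies of each ordinal below `α`,
and an end marker `none`. -/
abbrev TreeLabel (α : Ordinal.{0}) : Type 1 := Option (Set.Iio α × ℕ)

namespace TreeLabel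

variable {α : Ordinal.{0}}

/-- The ordinal carried by a label; the end marker carries `0`. -/
noncomputable def rank : TreeLabel α → Ordinal.{0}
  | none => 0
  | some p => p.1

/-- Finite sequences of labels with strictly decreasing ranks, padded with `none`. -/
def IsDescending (f : ℕ → TreeLabel α) : Prop :=
  ∀ i, f (i + 1) = none ∨ rank (f (i + 1)) < rank (f i)

@[simp]
theorem rank_none : rank (none : TreeLabel α) = 0 := rfl

@[simp]
theorem rank_some (p : Set.Iio α × ℕ) : rank (some p : TreeLabel α) = p.1 := rfl

theorem rank_lt (h : 0 < α) (x : TreeLabel α) : rank x < α := by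
  cases x with
  | none => exact h
  | some p => exact p.1.2

namespace IsDescending

variable {f g : ℕ → TreeLabel α}

theorem eq_none_or_rank_lt (hf : IsDescending f) {k l : ℕ} (h : k < l) :
    f l = none ∨ rank (f l) < rank (f k) := by
  induction l, h using Nat.le_induction with
  | base => exact hf k
  | succ l _ ih =>
    rcases hf l with h | h
    · exact Or.inl h
    · rcases ih with h' | h'
      · simp [h'] at h
      · exact Or.inr (h.trans h')

theorem eq_none_of_rank_eq_zero (hf : IsDescending f) {k l : ℕ} (h : k < l)
    (hk : rank (f k) = 0) : f l = none := by
  rcases hf.eq_none_or_rank_lt h with h | h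
  · exact h
  · simp [hk] at h

theorem exists_eq_none (hf : IsDescending f) : ∃ k, f k = none := by
  by_contra! h
  obtain ⟨k, hk⟩ := WellFounded.not_rel_apply_succ (r := ((· < ·) : Ordinal.{0} → _ → Prop))
    (fun k => rank (f k))
  exact hk ((hf k).resolve_left (h _))

/-- A descending sequence is determined by its values up to an index where its rank is `0`. -/
theorem eq_of_mem_cylinder (hf : IsDescending f) (hg : IsDescending g) {k : ℕ}
    (hk : rank (f k) = 0) (h : g ∈ PiNat.cylinder f (k + 1)) : g = f := by
  funext i
  rcases Nat.lt_or_ge i (k + 1) with hi | hi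
  · exact h i hi
  · rw [hf.eq_none_of_rank_eq_zero hi hk,
      hg.eq_none_of_rank_eq_zero hi (by rw [h k (Nat.lt_succ_self k), hk])]

end IsDescending

/-- Replace the entries of `f` after the index `k` by the single label `x`. -/
def extend (f : ℕ → TreeLabel α) (k : ℕ) (x : TreeLabel α) : ℕ → TreeLabel α :=
  fun i => if i ≤ k then f i else if i = k + 1 then x else none

theorem extend_apply_succ (f : ℕ → TreeLabel α) (k : ℕ) (x : TreeLabel α) :
    extend f k x (k + 1) = x := by simp [extend]

theorem extend_mem_cylinder (f : ℕ → TreeLabel α) (k : ℕ) (x : TreeLabel α) :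
    extend f k x ∈ PiNat.cylinder f (k + 1) := fun i hi => by
  simp [extend, Nat.lt_succ_iff.mp hi]

theorem IsDescending.extend {f : ℕ → TreeLabel α} (hf : IsDescending f) {k : ℕ} {x : TreeLabel α}
    (hx : rank x < rank (f k)) : IsDescending (extend f k x) := by
  intro i
  rcases lt_trichotomy i k with h | rfl | h
  · simpa [TreeLabel.extend, h.le, Nat.succ_le_of_lt h] using hf i
  · right
    simpa [TreeLabel.extend] using hx
  · left
    simp [TreeLabel.extend, h.ne', show ¬ i + 1 ≤ k by lia]

/-- The sequence consisting of the single label `x`. -/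
def single (x : TreeLabel α) : ℕ → TreeLabel α := fun i => if i = 0 then x else none

theorem isDescending_single (x : TreeLabel α) : IsDescending (single x) :=
  fun i => Or.inl (by simp [single])

theorem countable (hα : α.card ≤ Cardinal.aleph0) : Countable (TreeLabel α) := by
  have : Countable (Set.Iio α) := by
    rw [← Cardinal.mk_le_aleph0_iff, Cardinal.mk_Iio_ordinal]
    rwa [← Cardinal.lift_aleph0.{1, 0}, Cardinal.lift_le]
  infer_instance

theorem countable_isDescending (hα : α.card ≤ Cardinal.aleph0) :
    Countable {f : ℕ → TreeLabel α // IsDescending f} := by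
  have := countable hα
  choose N hN using fun f : {f : ℕ → TreeLabel α // IsDescending f} => f.2.exists_eq_none
  refine Function.Injective.countable
    (f := fun f => PiNat.res f.1 (N f + 1)) fun f g h => ?_
  have hlen : N f = N g := by simpa using congrArg List.length h
  have hres : PiNat.res g.1 (N f + 1) = PiNat.res f.1 (N f + 1) := by
    simpa [hlen] using h.symm
  refine Subtype.ext (IsDescending.eq_of_mem_cylinder f.2 g.2 (k := N f) (by simp [hN]) ?_).symm
  rwa [PiNat.cylinder_eq_res]

theorem infinite_isDescending (h : 0 < α) :
    Infinite {f : ℕ → TreeLabel α // IsDescending f} := by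
  refine Infinite.of_injective
    (fun n : ℕ => ⟨single (some (⟨0, h⟩, n)), isDescending_single _⟩) fun m n hmn => ?_
  simpa [single] using congrFun (Subtype.ext_iff.mp hmn) 0

end TreeLabel

section PiNatDist

attribute [local instance] PiNat.dist

theorem PiNat.scaled_dist_lt_iff {E : ℕ → Type*} (x y : ∀ n, E n) (n : ℕ) :
    3 / 4 * dist y x < (1 / 2 : ℝ) ^ n ↔ y ∈ PiNat.cylinder x n := by
  rcases eq_or_ne y x with rfl | h
  · simp [PiNat.dist_self]
  rw [PiNat.mem_cylinder_iff_le_firstDiff h, PiNat.dist_eq_of_ne h]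
  have hpos : ∀ m : ℕ, (0 : ℝ) < (1 / 2 : ℝ) ^ m := fun m => by positivity
  constructor
  · intro hlt
    by_contra! hn
    have := pow_le_pow_of_le_one (a := (1 / 2 : ℝ)) (by norm_num) (by norm_num) hn
    rw [pow_succ] at this
    linarith [hpos (PiNat.firstDiff y x)]
  · intro hn
    have := pow_le_pow_of_le_one (a := (1 / 2 : ℝ)) (by norm_num) (by norm_num) hn
    linarith [hpos (PiNat.firstDiff y x)]

theorem PiNat.scaled_dist_le_iff {E : ℕ → Type*} (x y : ∀ n, E n) (n : ℕ) :
    3 / 4 * dist y x ≤ (1 / 2 : ℝ) ^ n ↔ y ∈ PiNat.cylinder x n := by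
  refine ⟨fun h => ?_, fun h => ((PiNat.scaled_dist_lt_iff x y n).mpr h).le⟩
  rw [← PiNat.scaled_dist_lt_iff]
  refine lt_of_le_of_ne h fun heq => ?_
  rcases eq_or_ne y x with rfl | hne
  · rw [PiNat.dist_self, mul_zero] at heq
    exact absurd heq.symm (by positivity)
  rw [PiNat.dist_eq_of_ne hne] at heq
  have hpos : (0 : ℝ) < (1 / 2 : ℝ) ^ PiNat.firstDiff y x := by positivity
  rcases Nat.lt_or_ge (PiNat.firstDiff y x) n with hn | hn
  · have := pow_le_pow_of_le_one (a := (1 / 2 : ℝ)) (by norm_num) (by norm_num)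
      (Nat.succ_le_of_lt hn)
    rw [Nat.succ_eq_add_one, pow_succ] at this
    linarith
  · have := pow_le_pow_of_le_one (a := (1 / 2 : ℝ)) (by norm_num) (by norm_num) hn
    linarith

namespace Presentation

open TreeLabel

/-- The presentation of `ℕ` obtained by enumerating the descending sequences of labels. -/
noncomputable def ofTree {α : Ordinal.{0}}
    (e : ℕ ≃ {f : ℕ → TreeLabel α // IsDescending f}) : Presentation ℕ where
  dist m n := 3 / 4 * Dist.dist (e m).1 (e n).1
  seq := id
  dist_self m := by simp [PiNat.dist_self]
  eq_of_dist_eq_zero m n h :=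
    e.injective (Subtype.ext (PiNat.eq_of_dist_eq_zero _ _ (by linarith)))
  dist_comm m n := by rw [PiNat.dist_comm]
  dist_triangle l m n := by linarith [PiNat.dist_triangle (e l).1 (e m).1 (e n).1]
  isOpen_iff s := by
    refine ⟨fun _ x hx => ?_, fun _ => isOpen_discrete s⟩
    obtain ⟨k, hk⟩ := (e x).2.exists_eq_none
    refine ⟨(1 / 2 : ℝ) ^ (k + 1), by positivity, fun y hy => ?_⟩
    rw [PiNat.scaled_dist_lt_iff] at hy
    have := (e x).2.eq_of_mem_cylinder (e y).2 (by simp [hk]) hy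
    rwa [e.injective (Subtype.ext this)]
  complete u hu := by
    have hu' : ∀ k : ℕ, ∃ N, ∀ m ≥ N, ∀ n ≥ N,
        (e (u m)).1 ∈ PiNat.cylinder (e (u n)).1 (k + 1) := fun k => by
      obtain ⟨N, hN⟩ := hu ((1 / 2 : ℝ) ^ (k + 1)) (by positivity)
      exact ⟨N, fun m hm n hn => (PiNat.scaled_dist_lt_iff _ _ _).mp (hN m hm n hn)⟩
    choose N hN using hu'
    have hlim : ∀ k, ∀ m ≥ N k, ∀ i ≤ k, (e (u m)).1 i = (e (u (N i))).1 i := by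
      intro k m hm i hi
      set l := max (N k) (N i)
      rw [hN k m hm l (le_max_left _ _) i (Nat.lt_succ_of_le hi),
        hN i l (le_max_right _ _) (N i) le_rfl i (Nat.lt_succ_self i)]
    have hg : IsDescending fun i => (e (u (N i))).1 i := fun i => by
      have := (e (u (N (i + 1)))).2 i
      rwa [hlim (i + 1) (N (i + 1)) le_rfl i (Nat.le_succ i)] at this
    obtain ⟨k, hk⟩ := hg.exists_eq_none
    refine ⟨e.symm ⟨_, hg⟩, fun ε hε => ⟨N k, fun n hn => ?_⟩⟩
    have : (e (u n)).1 = fun i => (e (u (N i))).1 i :=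
      hg.eq_of_mem_cylinder (k := k) (e (u n)).2 (by simp [hk])
        fun i hi => hlim k n hn i (Nat.lt_succ_iff.mp hi)
    simpa [this, PiNat.dist_self] using hε
  dense x ε hε := ⟨x, by simpa [PiNat.dist_self] using hε⟩

section Rank

variable {α : Ordinal.{0}} (e : ℕ ≃ {f : ℕ → TreeLabel α // IsDescending f})

theorem mem_ball_ofTree (n : ℕ × ℕ) (x : ℕ) :
    x ∈ (ofTree e).ball n ↔ (e x).1 ∈ PiNat.cylinder (e n.1).1 (n.2 + 1) :=
  PiNat.scaled_dist_lt_iff _ _ _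

theorem mem_cball_ofTree (n : ℕ × ℕ) (x : ℕ) :
    x ∈ (ofTree e).cball n ↔ (e x).1 ∈ PiNat.cylinder (e n.1).1 (n.2 + 1) :=
  PiNat.scaled_dist_le_iff _ _ _

theorem dist_ofTree_le (m n : ℕ) : (ofTree e).dist m n ≤ 1 := by
  have := PiNat.dist_le_one (e m).1 (e n).1
  change 3 / 4 * Dist.dist (e m).1 (e n).1 ≤ 1
  linarith

theorem code_ofTree_univ : (ofTree e).code univ = univ :=
  eq_univ_of_forall fun n => ⟨n.1, (mem_ball_ofTree e n n.1).mpr (PiNat.self_mem_cylinder _ _),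
    trivial⟩

theorem deriv_ofTree (β : Ordinal.{0}) :
    (ofTree e).deriv {n | β ≤ rank ((e n.1).1 n.2)} = {n | β + 1 ≤ rank ((e n.1).1 n.2)} := by
  ext ⟨a, k⟩
  simp only [deriv, mem_ofPred_eq, ← Order.succ_eq_add_one, Order.succ_le_iff]
  constructor
  · rintro ⟨-, ⟨b, l⟩, hu, ⟨c, m⟩, hv, hau, hav, huv⟩
    have hb : (e b).1 ∈ PiNat.cylinder (e a).1 (k + 1) := (mem_ball_ofTree e _ _).mp
      (hau.2 ((mem_cball_ofTree e (b, l) b).mpr (PiNat.self_mem_cylinder _ _)))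
    have hc : (e c).1 ∈ PiNat.cylinder (e a).1 (k + 1) := (mem_ball_ofTree e _ _).mp
      (hav.2 ((mem_cball_ofTree e (c, m) c).mpr (PiNat.self_mem_cylinder _ _)))
    rcases (e b).2.eq_none_or_rank_lt hau.1 with hl | hl
    · simp only [hl, rank_none, nonpos_iff_eq_zero] at hu
      rw [hu, pos_iff_ne_zero]
      intro h0
      have hba := e.injective (Subtype.ext ((e a).2.eq_of_mem_cylinder (e b).2 h0 hb))
      have hca := e.injective (Subtype.ext ((e a).2.eq_of_mem_cylinder (e c).2 h0 hc))
      have hbc : b = c := hba.trans hca.symm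
      subst hbc
      exact eq_empty_iff_forall_notMem.mp huv b ⟨(mem_cball_ofTree e _ _).mpr (PiNat.self_mem_cylinder _ _),
        (mem_cball_ofTree e _ _).mpr (PiNat.self_mem_cylinder _ _)⟩
    · rw [← hb k (Nat.lt_succ_self k)]
      exact hu.trans_lt hl
  · intro h
    have hβ : β < α := by
      cases hx : (e a).1 k with
      | none => simp [hx] at h
      | some p =>
        rw [hx] at h
        exact h.trans p.1.2
    let x : ℕ → TreeLabel α := fun i => some (⟨β, hβ⟩, i)
    let b : ℕ → ℕ := fun i => e.symm ⟨_, (e a).2.extend (x := x i) h⟩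
    have hb : ∀ i, (e (b i)).1 = extend (e a).1 k (x i) := fun i => by simp [b]
    have hmem : ∀ i, β ≤ rank ((e (b i)).1 (k + 1)) := fun i => by
      rw [hb, extend_apply_succ]
      exact le_rfl
    have hprec : ∀ i, (ofTree e).prec (a, k) (b i, k + 1) := fun i => by
      refine ⟨Nat.lt_succ_self k, fun y hy => ?_⟩
      rw [mem_cball_ofTree, hb] at hy
      rw [mem_ball_ofTree]
      intro j hj
      rw [hy j (hj.trans (Nat.lt_succ_self _)), extend_mem_cylinder _ _ _ j hj]
    refine ⟨h.le, (b 0, k + 1), hmem 0, (b 1, k + 1), hmem 1, hprec 0, hprec 1, ?_⟩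
    refine eq_empty_of_forall_notMem fun y hy => ?_
    have h0 := (mem_cball_ofTree e _ _).mp hy.1 (k + 1) (Nat.lt_succ_self _)
    have h1 := (mem_cball_ofTree e _ _).mp hy.2 (k + 1) (Nat.lt_succ_self _)
    rw [h0] at h1
    simp [hb, extend_apply_succ, x] at h1

theorem derivIter_ofTree (β : Ordinal.{0}) :
    (ofTree e).derivIter univ β = {n | β ≤ rank ((e n.1).1 n.2)} := by
  induction β using Ordinal.limitRecOn with
  | zero => simp [derivIter]
  | add_one β ih =>
    rw [← deriv_ofTree, ← ih]
    simp [derivIter]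
  | limit β hβ ih =>
    have : (ofTree e).derivIter univ β =
        ⋂ γ : {γ : Ordinal.{0} // γ < β}, (ofTree e).derivIter univ γ.1 := by
      simp [derivIter, Ordinal.limitRecOn_limit _ _ _ _ hβ]
    rw [this]
    ext n
    simp only [mem_iInter, Subtype.forall, mem_ofPred_eq]
    rw [hβ.isSuccPrelimit.le_iff_forall_le]
    exact forall₂_congr fun γ hγ => by rw [ih γ hγ, mem_ofPred_eq]

theorem phi_ofTree_univ (h : 0 < α) : (ofTree e).phi univ = α := by
  rw [phi, code_ofTree_univ, rankA]
  simp only [derivIter_ofTree]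
  have hα : ∀ n : ℕ × ℕ, rank ((e n.1).1 n.2) < α := fun n => rank_lt h _
  refine IsLeast.csInf_eq ⟨?_, fun β hβ => ?_⟩
  · ext n
    simp only [mem_ofPred_eq, Order.add_one_le_iff]
    exact iff_of_false (hα n).not_gt (hα n).not_ge
  · by_contra! hlt
    let a := e.symm ⟨_, isDescending_single (some (⟨β, hlt⟩, 0))⟩
    have ha : rank ((e a).1 0) = β := by simp [a, single]
    have hmem : (a, 0) ∈ {n : ℕ × ℕ | β ≤ rank ((e n.1).1 n.2)} := ha.ge
    rw [← mem_ofPred_eq.mp hβ, mem_ofPred_eq, ha] at hmem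
    exact (Order.lt_add_one_iff.mpr le_rfl).not_ge hmem

end Rank

end Presentation

end PiNatDist

/-- For every countable ordinal `α ≥ 1` there is a presentation
`P_α = (ω, d_α, id)` of the discrete Polish space `ω` with `d_α` of finite diameter and
`φ_{P_α}(ω) = α`. -/
theorem stmt17 (α : Ordinal.{0}) (h1 : 1 ≤ α) (hα : α.card ≤ Cardinal.aleph0) :
    ∃ P : Presentation ℕ, P.seq = id ∧ (∃ C : ℝ, ∀ i j : ℕ, P.dist i j ≤ C) ∧
      P.phi Set.univ = α := by
  have h : 0 < α := zero_lt_one.trans_le h1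
  have := TreeLabel.countable_isDescending hα
  have := TreeLabel.infinite_isDescending h
  obtain ⟨_⟩ := nonempty_denumerable {f : ℕ → TreeLabel α // TreeLabel.IsDescending f}
  let e := (Denumerable.eqv {f : ℕ → TreeLabel α // TreeLabel.IsDescending f}).symm
  exact ⟨.ofTree e, rfl, ⟨1, Presentation.dist_ofTree_le e⟩, Presentation.phi_ofTree_univ e h⟩
end
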